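/- Let n ≥ 0, d ≥ 1, s ≥ 1 and a_1, ..., a_s positive integers. Define C_{a} := binom(n+1+d, n+1) − Σ_{k=1}^{s} (-1)^{k-1} Σ binom(n+1+d - a_{i_1} - ⋯ - a_{i_k}, n+1), where the inner sum runs over all k-element multisubsets {a_{i_1},...,a_{i_k}} of the list (a_1,...,a_s) with a_{i_1}+⋯+a_{i_k} ≤ d. If f_1, ..., f_s ∈ C[x_0, ..., x_{n+1}] is a regular sequence of homogeneous polynomials with deg f_i = a_i (so in particular s ≤ n+2), then the dimension of the degree-d graded piece of C[x_0,...,x_{n+1}]/(f_1,...,f_s) equals C_a. -/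

import Mathlib

open MvPolynomial

attribute [local instance] MvPolynomial.gradedAlgebra

/-- Hilbert function of the quotient by an ideal. -/
noncomputable def hilbQ {n : ℕ} (I : Ideal (MvPolynomial (Fin (n+2)) ℂ)) (d : ℕ) : ℕ :=
  Module.finrank ℂ (Submodule.map (Ideal.Quotient.mkₐ ℂ I).toLinearMap
        (homogeneousSubmodule (Fin (n+2)) ℂ d))

lemma finrank_homog (n d : ℕ) :
    Module.finrank ℂ (homogeneousSubmodule (Fin (n+2)) ℂ d) = Nat.choose (n+1+d) (n+1) := by
  rw [homogeneousSubmodule_eq_finsupp_supported]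
  rw [(AddMonoidAlgebra.supportedEquivFinsupp (R := ℂ) (S := ℂ)
    {e : Fin (n+2) →₀ ℕ | e.degree = d}).finrank_eq]
  have h : {e : Fin (n+2) →₀ ℕ | e.degree = d} =
      ((Finset.univ : Finset (Fin (n+2))).finsuppAntidiag d : Set (Fin (n+2) →₀ ℕ)) := by
    ext e
    simp [Finsupp.degree_eq_sum]
  rw [h, Module.finrank_finsupp_self]
  simp only [SetLike.coe_sort_coe, Fintype.card_coe]
  rw [Finset.card_finsuppAntidiag_nat_eq_choose]
  simp only [Finset.card_univ, Fintype.card_fin]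
  rw [show n + 2 + d - 1 = n + 1 + d by omega]
  exact (Nat.choose_symm_add).symm

lemma finrank_map_inf_ker {V W : Type*} [AddCommGroup V] [Module ℂ V] [AddCommGroup W]
    [Module ℂ W] (φ : V →ₗ[ℂ] W) (p : Submodule ℂ V) [FiniteDimensional ℂ p] :
    Module.finrank ℂ (p.map φ) + Module.finrank ℂ (p ⊓ LinearMap.ker φ : Submodule ℂ V) =
      Module.finrank ℂ p := by
  have h := (φ.domRestrict p).finrank_range_add_finrank_ker
  rw [LinearMap.range_domRestrict, LinearMap.ker_domRestrict] at h
  rw [← h]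
  congr 1
  rw [← Submodule.map_comap_subtype]
  exact (Submodule.equivMapOfInjective p.subtype p.injective_subtype _).finrank_eq.symm

lemma hilbQ_step {n : ℕ} (I J : Ideal (MvPolynomial (Fin (n+2)) ℂ))
    (hI : I.IsHomogeneous (homogeneousSubmodule (Fin (n+2)) ℂ))
    (f : MvPolynomial (Fin (n+2)) ℂ) (a : ℕ) (hf : f.IsHomogeneous a)
    (hJ : J = I ⊔ Ideal.span {f}) (hreg : ∀ g, f * g ∈ I → g ∈ I) (d : ℕ) :
    hilbQ J d + (if a ≤ d then hilbQ I (d - a) else 0) = hilbQ I d := by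
  have hIJ : I ≤ J := hJ ▸ le_sup_left
  have hfJ : f ∈ J := hJ ▸ (le_sup_right : _ ≤ I ⊔ _) (Ideal.mem_span_singleton_self f)
  set φ := (Ideal.Quotient.factorₐ ℂ hIJ).toLinearMap with hφ
  have hfin : FiniteDimensional ℂ (homogeneousSubmodule (Fin (n+2)) ℂ d) :=
    Module.Finite.iff_fg.2 (homogeneousSubmodule_fg _ _ d)
  have key := finrank_map_inf_ker φ (Submodule.map (Ideal.Quotient.mkₐ ℂ I).toLinearMap
        (homogeneousSubmodule (Fin (n+2)) ℂ d))
  have e1 : Submodule.map φ (Submodule.map (Ideal.Quotient.mkₐ ℂ I).toLinearMap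
        (homogeneousSubmodule (Fin (n+2)) ℂ d)) =
      Submodule.map (Ideal.Quotient.mkₐ ℂ J).toLinearMap
        (homogeneousSubmodule (Fin (n+2)) ℂ d) := by
    rw [← Submodule.map_comp]
    rfl
  rw [e1] at key
  unfold hilbQ
  rw [← key]
  congr 1
  have hx : ∀ x : MvPolynomial (Fin (n+2)) ℂ, x.IsHomogeneous d → x ∈ J →
      ∃ g, x - (if a ≤ d then f * (DirectSum.decompose (homogeneousSubmodule (Fin (n+2)) ℂ) g
        (d - a) : MvPolynomial (Fin (n+2)) ℂ) else 0) ∈ I := by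
    intro x hx hxJ
    rw [hJ, Submodule.mem_sup] at hxJ
    obtain ⟨i, hi, y, hy, rfl⟩ := hxJ
    obtain ⟨g, rfl⟩ := Ideal.mem_span_singleton'.1 hy
    refine ⟨g, ?_⟩
    have h1 := DirectSum.decompose_of_mem_same (homogeneousSubmodule (Fin (n+2)) ℂ) hx
    have h2 := DirectSum.coe_decompose_mul_of_left_mem (homogeneousSubmodule (Fin (n+2)) ℂ)
      (b := g) d (show f ∈ _ from hf)
    rw [DirectSum.decompose_add, DirectSum.add_apply, Submodule.coe_add, mul_comm g f, h2] at h1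
    rw [mul_comm g f, ← h1, add_sub_cancel_right]
    exact hI d hi
  have hker : ∀ x, φ (Ideal.Quotient.mkₐ ℂ I x) = 0 ↔ x ∈ J := fun x => 
    Ideal.Quotient.eq_zero_iff_mem (I := J)
  split_ifs with had
  · have hinj : Function.Injective (LinearMap.mulLeft ℂ (Ideal.Quotient.mk I f)) := by
      rw [← LinearMap.ker_eq_bot, LinearMap.ker_eq_bot']
      intro y hy
      obtain ⟨g, rfl⟩ := Ideal.Quotient.mk_surjective y
      rw [LinearMap.mulLeft_apply, ← map_mul, Ideal.Quotient.eq_zero_iff_mem] at hy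
      exact Ideal.Quotient.eq_zero_iff_mem.2 (hreg g hy)
    rw [(Submodule.equivMapOfInjective _ hinj _).finrank_eq]
    refine congrArg (fun q : Submodule ℂ (MvPolynomial (Fin (n+2)) ℂ ⧸ I) => Module.finrank ℂ q) ?_
    ext y
    constructor
    · rintro ⟨_, ⟨g, hg, rfl⟩, rfl⟩
      refine ⟨⟨f * g, ?_, by simp⟩, ?_⟩
      · have := IsHomogeneous.mul hf hg
        rwa [Nat.add_sub_cancel' had] at this
      · refine (hker (f * g)).2 (Ideal.mul_mem_right _ _ hfJ)
    · rintro ⟨⟨x, hxd, rfl⟩, h0⟩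
      obtain ⟨g, hg⟩ := hx x hxd ((hker x).1 h0)
      rw [if_pos had] at hg
      refine ⟨_, ⟨_, SetLike.coe_mem (DirectSum.decompose (homogeneousSubmodule (Fin (n+2)) ℂ) g
        (d - a)), rfl⟩, ?_⟩
      exact (Ideal.Quotient.eq.2 hg).symm
  · symm
    have hbot : Submodule.map (Ideal.Quotient.mkₐ ℂ I).toLinearMap
        (homogeneousSubmodule (Fin (n+2)) ℂ d) ⊓ LinearMap.ker φ = ⊥ := by
      rw [eq_bot_iff]
      rintro _ ⟨⟨x, hxd, rfl⟩, h0⟩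
      obtain ⟨g, hg⟩ := hx x hxd ((hker x).1 h0)
      rw [if_neg had, sub_zero] at hg
      exact Ideal.Quotient.eq_zero_iff_mem.2 hg
    rw [hbot, finrank_bot]

lemma hilbQ_main (n s : ℕ) (a : Fin s → ℕ)
    (f : Fin s → MvPolynomial (Fin (n+2)) ℂ)
    (hf : ∀ i, (f i).IsHomogeneous (a i))
    (hreg : RingTheory.Sequence.IsWeaklyRegular (MvPolynomial (Fin (n+2)) ℂ) (List.ofFn f))
    (t : ℕ) (ht : t ≤ s) : ∀ d : ℕ,
    (hilbQ (Ideal.span (f '' {j | j.val < t})) d : ℤ) =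
      ∑ S ∈ (Finset.univ.filter (fun j : Fin s => j.val < t)).powerset,
        (-1 : ℤ) ^ S.card * (if ∑ i ∈ S, a i ≤ d then
          (Nat.choose (n+1+d - ∑ i ∈ S, a i) (n+1) : ℤ) else 0) := by
  induction t with
  | zero =>
    intro d
    simp only [not_lt_zero, Set.ofPred_false, Set.image_empty, Ideal.span_empty, Finset.filter_false,
      Finset.powerset_empty, Finset.sum_singleton]
    simp only [Finset.card_empty, pow_zero, one_mul, Finset.sum_empty, zero_le, if_true, tsub_zero]
    rw [← finrank_homog]
    have hinj : Function.Injective (Ideal.Quotient.mkₐ ℂ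
        (⊥ : Ideal (MvPolynomial (Fin (n+2)) ℂ))).toLinearMap := by
      intro x y h
      have := Ideal.Quotient.eq.1 h
      rwa [Ideal.mem_bot, sub_eq_zero] at this
    unfold hilbQ
    rw [(Submodule.equivMapOfInjective _ hinj _).finrank_eq]
  | succ t ih =>
    intro d
    have ih := ih (by omega)
    set k : Fin s := ⟨t, ht⟩ with hk
    have hset : {j : Fin s | j.val < t + 1} = insert k {j : Fin s | j.val < t} := by
      ext j
      simp [hk, Fin.ext_iff]
      omega
    have hfs : Finset.univ.filter (fun j : Fin s => j.val < t + 1) =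
        insert k (Finset.univ.filter (fun j : Fin s => j.val < t)) := by
      ext j
      simp [hk, Fin.ext_iff]
      omega
    have hnot : k ∉ Finset.univ.filter (fun j : Fin s => j.val < t) := by simp [hk]
    have hstep := hilbQ_step (Ideal.span (f '' {j | j.val < t}))
      (Ideal.span (f '' {j | j.val < t + 1}))
      (Ideal.homogeneous_span _ _ (by
        rintro _ ⟨j, _, rfl⟩
        exact ⟨a j, hf j⟩)) (f k) (a k) (hf k)
      (by rw [hset, Set.image_insert_eq, Ideal.span_insert, sup_comm])
      (by
        intro g hg
        have h := hreg.regular_mod_prev t (by simpa using ht)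
        have hL : Ideal.ofList ((List.ofFn f).take t) = Ideal.span (f '' {j | j.val < t}) := by
          unfold Ideal.ofList
          congr 1
          ext x
          simp only [Set.mem_ofPred_eq, List.mem_take_iff_getElem, List.getElem_ofFn, Set.mem_image,
            List.length_ofFn]
          constructor
          · rintro ⟨i, hi, rfl⟩
            exact ⟨⟨i, by omega⟩, by show i < t; omega, rfl⟩
          · rintro ⟨j, hj, rfl⟩
            exact ⟨j, by have h1 : j.val < t := hj; have := j.2; omega, rfl⟩
        rw [hL, isSMulRegular_quotient_iff_mem_of_smul_mem] at h
        have := h g (by simpa using hg)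
        simpa using this) d
    have h2 : (hilbQ (Ideal.span (f '' {j | j.val < t + 1})) d : ℤ) =
        hilbQ (Ideal.span (f '' {j | j.val < t})) d -
        (if a k ≤ d then (hilbQ (Ideal.span (f '' {j | j.val < t})) (d - a k) : ℤ) else 0) := by
      rw [← hstep]
      push_cast
      ring
    rw [h2, hfs, Finset.sum_powerset_insert hnot, ih d, ih (d - a k), sub_eq_add_neg]
    congr 1
    split_ifs with h
    · rw [← Finset.sum_neg_distrib]
      refine Finset.sum_congr rfl fun S hS => ?_
      have hkS : k ∉ S := fun h => hnot (Finset.mem_powerset.1 hS h)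
      rw [Finset.card_insert_of_notMem hkS, Finset.sum_insert hkS, pow_succ]
      have e1 : (∑ i ∈ S, a i ≤ d - a k) ↔ (a k + ∑ i ∈ S, a i ≤ d) := by omega
      have e2 : n + 1 + (d - a k) - ∑ i ∈ S, a i = n + 1 + d - (a k + ∑ i ∈ S, a i) := by omega
      simp only [e1, e2]
      ring
    · rw [neg_zero]
      symm
      refine Finset.sum_eq_zero fun S hS => ?_
      have hkS : k ∉ S := fun h => hnot (Finset.mem_powerset.1 hS h)
      rw [Finset.sum_insert hkS, if_neg (by omega), mul_zero]

/-- Koszul-complex dimension count: if `f_1, …, f_s` is a regular sequence of homogeneous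
polynomials in `ℂ[x_0, …, x_{n+1}]` with `deg f_i = a_i`, then the dimension of the degree-`d`
graded piece of `ℂ[x]/(f_1, …, f_s)` equals
`C_a = binom(n+1+d, n+1) - Σ_{k=1}^s (-1)^{k-1} Σ_{a_{i_1}+⋯+a_{i_k} ≤ d} binom(n+1+d-a_{i_1}-⋯-a_{i_k}, n+1)`. -/
theorem stmt_10 (n d s : ℕ) (hd : 1 ≤ d) (hs : 1 ≤ s)
    (a : Fin s → ℕ) (ha : ∀ i, 0 < a i)
    (f : Fin s → MvPolynomial (Fin (n+2)) ℂ)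
    (hf : ∀ i, (f i).IsHomogeneous (a i))
    (hreg : RingTheory.Sequence.IsRegular (MvPolynomial (Fin (n+2)) ℂ) (List.ofFn f)) :
    (Module.finrank ℂ
      (Submodule.map (Ideal.Quotient.mkₐ ℂ (Ideal.span (Set.range f))).toLinearMap
        (homogeneousSubmodule (Fin (n+2)) ℂ d)) : ℤ) =
    (Nat.choose (n+1+d) (n+1) : ℤ) -
      ∑ k ∈ Finset.Icc 1 s, (-1 : ℤ)^(k-1) *
        ∑ S ∈ (Finset.univ.powersetCard k).filter
            (fun S : Finset (Fin s) => ∑ i ∈ S, a i ≤ d),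
          (Nat.choose (n+1+d - ∑ i ∈ S, a i) (n+1) : ℤ) := by
  have h := hilbQ_main n s a f hf hreg.toIsWeaklyRegular s le_rfl d
  have h1 : f '' {j | j.val < s} = Set.range f := by
    rw [← Set.image_univ]
    congr 1
    ext j
    simp
  have h2 : Finset.univ.filter (fun j : Fin s => j.val < s) = Finset.univ := by
    ext j
    simp
  rw [h1, h2] at h
  unfold hilbQ at h
  rw [h, Finset.sum_powerset, Finset.card_univ, Fintype.card_fin, Finset.sum_range_succ']
  have h3 : Finset.Icc 1 s = Finset.Ico 1 (s + 1) := by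
    ext
    simp
  rw [h3, Finset.sum_Ico_eq_sum_range, add_comm, sub_eq_add_neg, ← Finset.sum_neg_distrib]
  congr 1
  · simp
  · refine Finset.sum_congr rfl fun k _ => ?_
    rw [add_comm 1 k, Nat.add_sub_cancel, Finset.sum_filter, ← neg_mul, Finset.mul_sum]
    refine Finset.sum_congr rfl fun S hS => ?_
    rw [(Finset.mem_powersetCard.1 hS).2, pow_succ]
    ring
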